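/- arXiv:1109.5330 — 2 statements merged into one kernel-verified Lean document; each statement's English description precedes it below -/
import Mathlib

section
/- Let D ⊆ T be domains with T an overring of D, Q a prime of T, q = Q ∩ D, and suppose the pullback D(Q) = D_q + QT_Q is a strong S-domain of finite Krull dimension. Then trdeg_{k(q)}(k(Q)) = 0, i.e., k(Q) is algebraic over k(q). -/
set_option synthInstance.maxHeartbeats 1000000
set_option maxHeartbeats 1000000

open Polynomial

/-- `D` is a quasi-Prüfer domain: for each prime `P` of `D` and each prime `Q` of `D[X]`
with `Q ⊆ P[X]`, one has `Q = (Q ∩ D)[X]`. -/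
def IsQuasiPrufer (D : Type*) [CommRing D] : Prop :=
  ∀ P : Ideal D, P.IsPrime → ∀ Q : Ideal D[X], Q.IsPrime →
    Q ≤ P.map (C : D →+* D[X]) → Q = (Q.comap (C : D →+* D[X])).map (C : D →+* D[X])

/-- `D` is a Prüfer domain: every nonzero finitely generated ideal is invertible
(as a fractional ideal in the fraction field). -/
def IsPruferDom (D : Type*) [CommRing D] [IsDomain D] : Prop :=
  ∀ I : Ideal D, I ≠ ⊥ → I.FG →
    IsUnit (I : FractionalIdeal (nonZeroDivisors D) (FractionRing D))

/-- The valuative dimension of a domain: the supremum of the Krull dimensions of its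
valuation overrings. -/
noncomputable def valuativeDim (R : Type*) [CommRing R] [IsDomain R] : WithBot ℕ∞ :=
  ⨆ (V : Subalgebra R (FractionRing R)) (_ : ValuationRing V), ringKrullDim V

/-- `P₁ ⊊ P₂` are adjacent primes: both prime, `P₁ < P₂`, and no prime strictly between. -/
def AdjacentPrimes {R : Type*} [CommRing R] (P₁ P₂ : Ideal R) : Prop :=
  P₁.IsPrime ∧ P₂.IsPrime ∧ P₁ < P₂ ∧ ∀ Q : Ideal R, Q.IsPrime → P₁ < Q → ¬ Q < P₂

/-- `D` is a strong S-domain: adjacent primes `P₁ ⊊ P₂` extend to adjacent primes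
`P₁[X] ⊊ P₂[X]` of `D[X]`. -/
def IsStrongS (D : Type*) [CommRing D] : Prop :=
  ∀ P₁ P₂ : Ideal D, AdjacentPrimes P₁ P₂ →
    AdjacentPrimes (P₁.map (C : D →+* D[X])) (P₂.map (C : D →+* D[X]))

/-- Transcendence degree: the supremum of cardinalities of algebraically independent
subsets. -/
noncomputable def trdeg (F E : Type*) [CommRing F] [CommRing E] [Algebra F E] : Cardinal :=
  ⨆ s : {s : Set E // AlgebraicIndependent F ((↑) : s → E)}, Cardinal.mk s.1

section Pullback

variable (D : Type*) [CommRing D] [IsDomain D] (T : Subalgebra D (FractionRing D))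
  (Q : Ideal T) [Q.IsPrime]

instance : IsDomain (Localization.AtPrime Q) :=
  IsLocalization.isDomain_localization Q.primeCompl_le_nonZeroDivisors

/-- The copy of the residue field `k(q) = Frac(D/q)` (where `q = Q ∩ D`) inside the residue
field `k(Q) = T_Q/QT_Q`: the subfield generated by the image of `D`. -/
noncomputable def kqSub : Subfield (IsLocalRing.ResidueField (Localization.AtPrime Q)) :=
  Subfield.closure (Set.range ((IsLocalRing.residue (Localization.AtPrime Q)).comp
    ((algebraMap T (Localization.AtPrime Q)).comp (algebraMap D T))))

/-- The pullback ring `D(Q) = D_q + QT_Q`: the preimage of `k(q) ⊆ k(Q)` under the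
canonical surjection `T_Q → k(Q)`. -/
noncomputable def DQ : Subring (Localization.AtPrime Q) :=
  (kqSub D T Q).toSubring.comap (IsLocalRing.residue (Localization.AtPrime Q))

end Pullback
section ComapResidue

open IsLocalRing

variable {A : Type*} [CommRing A] [IsLocalRing A] (F : Subfield (ResidueField A))

/-- The transporter of a prime `P` of the pullback of `F` along `A → A/M`: the set of `a` with
`a * M ⊆ P`. For `P` not containing `M` it is the unique prime of `A` lying over `P`. -/
def transporter (P : Ideal (F.toSubring.comap (residue A))) : Ideal A where
  carrier := {a | ∀ b : F.toSubring.comap (residue A), (b : A) ∈ maximalIdeal A →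
    ∃ p ∈ P, (p : A) = a * b}
  zero_mem' b _ := ⟨0, P.zero_mem, by simp⟩
  add_mem' {x y} hx hy b hb := by
    obtain ⟨p, hp, hpx⟩ := hx b hb
    obtain ⟨r, hr, hry⟩ := hy b hb
    exact ⟨p + r, P.add_mem hp hr, by push_cast; rw [hpx, hry]; ring⟩
  smul_mem' c x hx b hb := by
    have hcb : c * (b : A) ∈ maximalIdeal A := Ideal.mul_mem_left _ _ hb
    obtain ⟨p, hp, hpx⟩ := hx ⟨c * b, by
      change residue A _ ∈ F
      rw [(residue_eq_zero_iff _).2 hcb]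
      exact F.zero_mem⟩ hcb
    exact ⟨p, hp, by rw [hpx, smul_eq_mul]; ring⟩

lemma exists_comap_residue_eq {a : A} (ha : a ∈ maximalIdeal A) :
    ∃ b : F.toSubring.comap (residue A), (b : A) = a :=
  ⟨⟨a, by
    change residue A _ ∈ F
    rw [(residue_eq_zero_iff _).2 ha]
    exact F.zero_mem⟩, rfl⟩

variable {F}

lemma coe_mem_transporter_iff {P : Ideal (F.toSubring.comap (residue A))} [hP : P.IsPrime]
    {m : F.toSubring.comap (residue A)} (hm : (m : A) ∈ maximalIdeal A) (hmP : m ∉ P)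
    (b : F.toSubring.comap (residue A)) : (b : A) ∈ transporter F P ↔ b ∈ P := by
  refine ⟨fun h ↦ ?_, fun h c _ ↦ ⟨b * c, P.mul_mem_right _ h, rfl⟩⟩
  obtain ⟨p, hp, hpm⟩ := h m hm
  have : p = b * m := Subtype.ext hpm
  exact (hP.mem_or_mem (this ▸ hp)).resolve_right hmP

lemma transporter_isPrime {P : Ideal (F.toSubring.comap (residue A))} [hP : P.IsPrime]
    {m : F.toSubring.comap (residue A)} (hm : (m : A) ∈ maximalIdeal A) (hmP : m ∉ P) :
    (transporter F P).IsPrime := by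
  refine ⟨fun h ↦ ?_, fun {x y} hxy ↦ ?_⟩
  · have h1 : ((1 : F.toSubring.comap (residue A)) : A) ∈ transporter F P := h ▸ trivial
    exact hP.one_notMem ((coe_mem_transporter_iff hm hmP 1).1 h1)
  · by_contra! hcon
    obtain ⟨hx, hy⟩ := hcon
    have key : ∀ z ∉ transporter F P, ∃ c : F.toSubring.comap (residue A),
        ∃ b : F.toSubring.comap (residue A), (c : A) = z * b ∧ (b : A) ∈ maximalIdeal A ∧
          c ∉ P := by
      intro z hz
      by_contra! hc
      refine hz fun b hb ↦ ?_
      obtain ⟨c, hcz⟩ := exists_comap_residue_eq F (Ideal.mul_mem_left _ z hb)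
      exact ⟨c, hc c b hcz hb, hcz⟩
    obtain ⟨c, b, hc, hb, hcP⟩ := key x hx
    obtain ⟨c', b', hc', hb', hcP'⟩ := key y hy
    obtain ⟨p, hp, hpb⟩ := hxy b hb
    have : c * c' = p * b' := Subtype.ext (by push_cast; rw [hc, hc', hpb]; ring)
    rcases hP.mem_or_mem (this ▸ P.mul_mem_right b' hp : c * c' ∈ P) with h | h
    exacts [hcP h, hcP' h]

lemma transporter_le_maximalIdeal {P : Ideal (F.toSubring.comap (residue A))} [P.IsPrime]
    {m : F.toSubring.comap (residue A)} (hm : (m : A) ∈ maximalIdeal A) (hmP : m ∉ P) :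
    transporter F P ≤ maximalIdeal A :=
  le_maximalIdeal (transporter_isPrime hm hmP).ne_top

/-- In a ring of finite Krull dimension, every nonminimal prime has an adjacent prime below. -/
lemma exists_adjacentPrimes {R : Type*} [CommRing R] (hfin : ringKrullDim R < ⊤)
    {P M : Ideal R} [hP : P.IsPrime] [hM : M.IsPrime] (hlt : P < M) :
    ∃ P', AdjacentPrimes P' M := by
  have : Nonempty (PrimeSpectrum R) := ⟨⟨P, hP⟩⟩
  have : FiniteDimensionalOrder (PrimeSpectrum R) :=
    Order.finiteDimensionalOrder_iff_krullDim_ne_bot_and_top.2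
      ⟨Order.krullDim_ne_bot_iff.2 inferInstance, hfin.ne⟩
  have hwf : WellFounded fun x y : PrimeSpectrum R ↦ x > y :=
    SetRel.IsWellFounded.inv_of_finiteDimensional {(x, y) : PrimeSpectrum R × _ | x < y}
  obtain ⟨N, hN, hmax⟩ := hwf.has_min
    {N | N.asIdeal < M} ⟨⟨P, hP⟩, hlt⟩
  exact ⟨N.asIdeal, N.isPrime, hM, hN, fun Q hQ h1 h2 ↦ hmax ⟨Q, hQ⟩ h2 h1⟩

/-- If the pullback of a subfield `F` of the residue field of a local domain `A`, not a field,
is a strong S-domain of finite Krull dimension, then the residue field is algebraic over `F`. -/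
theorem isAlgebraic_of_isStrongS_comap_residue [IsDomain A]
    (hS : IsStrongS (F.toSubring.comap (residue A)))
    (hfin : ringKrullDim (F.toSubring.comap (residue A)) < ⊤)
    (hA : maximalIdeal A ≠ ⊥) : Algebra.IsAlgebraic F (ResidueField A) := by
  let B := F.toSubring.comap (residue A)
  let M : Ideal B := (maximalIdeal A).comap B.subtype
  have hM : M.IsPrime := Ideal.IsPrime.comap _
  have hbot : (⊥ : Ideal B) < M := by
    obtain ⟨a, ha, ha0⟩ := Submodule.exists_mem_ne_zero_of_ne_bot hA
    obtain ⟨b, rfl⟩ := exists_comap_residue_eq F ha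
    refine bot_lt_iff_ne_bot.2 fun h ↦ ha0 ?_
    have hb : b ∈ M := ha
    rw [h, Ideal.mem_bot] at hb
    simp [hb]
  obtain ⟨P, hadj⟩ := exists_adjacentPrimes hfin hbot
  have hP : P.IsPrime := hadj.1
  obtain ⟨m, hm, hmP⟩ := SetLike.exists_of_lt hadj.2.2.1
  have hprime : (transporter F P).IsPrime := transporter_isPrime hm hmP
  refine ⟨fun x ↦ ?_⟩
  obtain ⟨t, rfl⟩ := residue_surjective x
  by_contra htr
  let φ : B[X] →+* A := eval₂RingHom B.subtype t
  have hφC (b : B) : φ (C b) = b := eval₂_C _ _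
  refine (hS P M hadj).2.2.2 ((transporter F P).comap φ) (hprime.comap φ) ?_ ?_
  · refine SetLike.lt_iff_le_and_exists.2 ⟨Ideal.map_le_iff_le_comap.2 fun b hb ↦ ?_, ?_⟩
    · rw [Ideal.mem_comap, Ideal.mem_comap, hφC]
      exact (coe_mem_transporter_iff hm hmP b).2 hb
    · obtain ⟨c, hc⟩ := exists_comap_residue_eq F (Ideal.mul_mem_right t _ hm)
      refine ⟨C m * X - C c, ?_, fun h ↦ hmP ?_⟩
      · have : φ (C m * X - C c) = 0 := by
          rw [map_sub, map_mul, hφC, hφC, hc]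
          simp [φ]
        rw [Ideal.mem_comap, this]
        exact Ideal.zero_mem _
      · simpa using Ideal.mem_map_C_iff.1 h 1
  · refine SetLike.lt_iff_le_and_exists.2 ⟨fun f hf ↦ ?_, C m, Ideal.mem_map_of_mem C hm, ?_⟩
    · let ρ : B →+* F := ((residue A).comp B.subtype).codRestrict F.toSubring fun b ↦ b.2
      have hmem : residue A (φ f) = 0 :=
        (residue_eq_zero_iff _).2 (transporter_le_maximalIdeal hm hmP hf)
      have haeval : aeval (residue A t) (f.map ρ) = 0 := by
        rw [← hmem, aeval_def, eval₂_map, coe_eval₂RingHom, hom_eval₂]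
        rfl
      have hzero : f.map ρ = 0 := by
        by_contra h
        exact htr ⟨_, h, haeval⟩
      refine Ideal.mem_map_C_iff.2 fun n ↦ ?_
      have hn : ρ (f.coeff n) = 0 := by rw [← coeff_map, hzero, coeff_zero]
      exact (residue_eq_zero_iff _).1 (congrArg Subtype.val hn)
    · rw [Ideal.mem_comap, hφC]
      exact fun h ↦ hmP ((coe_mem_transporter_iff hm hmP m).1 h)

end ComapResidue

/-- If `T_Q` is a field, then the residue field of `T_Q` is `k(q)`. -/
lemma kqSub_eq_top (D : Type*) [CommRing D] [IsDomain D]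
    (T : Subalgebra D (FractionRing D)) (Q : Ideal T) [Q.IsPrime]
    (h : IsLocalRing.maximalIdeal (Localization.AtPrime Q) = ⊥) : kqSub D T Q = ⊤ := by
  let ψ : T →+* IsLocalRing.ResidueField (Localization.AtPrime Q) :=
    (IsLocalRing.residue _).comp (algebraMap T _)
  have hD (d : D) : ψ (algebraMap D T d) ∈ kqSub D T Q := Subfield.subset_closure ⟨d, rfl⟩
  have hres : Function.Injective (IsLocalRing.residue (Localization.AtPrime Q)) :=
    (injective_iff_map_eq_zero _).2 fun a ha ↦ by
      rwa [IsLocalRing.residue_eq_zero_iff, h, Ideal.mem_bot] at ha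
  have hψ : Function.Injective ψ :=
    hres.comp (IsLocalization.injective (Localization.AtPrime Q) Q.primeCompl_le_nonZeroDivisors)
  have hT (t : T) : ψ t ∈ kqSub D T Q := by
    obtain ⟨a, s, hs, hst⟩ := IsFractionRing.div_surjective (A := D) (t : FractionRing D)
    have hs0 : algebraMap D (FractionRing D) s ≠ 0 :=
      IsFractionRing.to_map_ne_zero_of_mem_nonZeroDivisors hs
    have hmul : t * algebraMap D T s = algebraMap D T a := Subtype.ext (by
      change (t : FractionRing D) * algebraMap D (FractionRing D) s = algebraMap D _ a
      rw [← hst, div_mul_cancel₀ _ hs0])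
    have hs1 : ψ (algebraMap D T s) ≠ 0 := fun h0 ↦ hs0
      (congrArg Subtype.val ((map_eq_zero_iff ψ hψ).1 h0))
    rw [eq_div_of_mul_eq hs1 ((map_mul ψ _ _).symm.trans (congrArg ψ hmul))]
    exact (kqSub D T Q).div_mem (hD a) (hD s)
  refine eq_top_iff.2 fun x _ ↦ ?_
  obtain ⟨y, rfl⟩ := IsLocalRing.residue_surjective x
  obtain ⟨t, s, rfl⟩ := IsLocalization.exists_mk'_eq Q.primeCompl y
  have hs : ψ s ≠ 0 := fun h0 ↦ s.2 (((map_eq_zero_iff ψ hψ).1 h0) ▸ Q.zero_mem)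
  have hmul : IsLocalRing.residue _ (IsLocalization.mk' (Localization.AtPrime Q) t s) * ψ s
      = ψ t := by
    change _ * IsLocalRing.residue _ (algebraMap T _ _) = IsLocalRing.residue _ (algebraMap T _ _)
    rw [← map_mul, IsLocalization.mk'_spec]
  rw [eq_div_of_mul_eq hs hmul]
  exact (kqSub D T Q).div_mem (hT t) (hT s)

lemma trdeg_eq_zero_of_isAlgebraic (F E : Type*) [Field F] [Field E] [Algebra F E]
    [Algebra.IsAlgebraic F E] : trdeg F E = 0 := by
  refine le_antisymm (ciSup_le' fun s ↦ ?_) zero_le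
  refine (Cardinal.mk_eq_zero_iff.2 ⟨fun x ↦ ?_⟩).le
  exact s.2.transcendental x (Algebra.IsAlgebraic.isAlgebraic _)

/-- If the pullback `D(Q) = D_q + QT_Q` is a strong S-domain of finite Krull
dimension, then `trdeg_{k(q)} k(Q) = 0`, i.e. `k(Q)` is algebraic over `k(q)`. -/
theorem statement_9 (D : Type*) [CommRing D] [IsDomain D]
    (T : Subalgebra D (FractionRing D)) (Q : Ideal T) [Q.IsPrime]
    (hS : IsStrongS (DQ D T Q)) (hfin : ringKrullDim (DQ D T Q) < ⊤) :
    trdeg (kqSub D T Q) (IsLocalRing.ResidueField (Localization.AtPrime Q)) = 0 ∧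
    Algebra.IsAlgebraic (kqSub D T Q)
      (IsLocalRing.ResidueField (Localization.AtPrime Q)) := by
  have halg : Algebra.IsAlgebraic (kqSub D T Q)
      (IsLocalRing.ResidueField (Localization.AtPrime Q)) := by
    by_cases h : IsLocalRing.maximalIdeal (Localization.AtPrime Q) = ⊥
    · refine ⟨fun x ↦ ?_⟩
      have hx : x ∈ kqSub D T Q := kqSub_eq_top D T Q h ▸ Subfield.mem_top x
      exact isAlgebraic_algebraMap (⟨x, hx⟩ : kqSub D T Q)
    · exact isAlgebraic_of_isStrongS_comap_residue hS hfin h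
  exact ⟨trdeg_eq_zero_of_isAlgebraic _ _, halg⟩
end

section
/- If D is a stably strong S-domain (i.e., D[X₁,...,Xₙ] is a strong S-domain for all n ≥ 0) of finite Krull dimension, then D is a Jaffard domain. -/
set_option synthInstance.maxHeartbeats 1000000
set_option maxHeartbeats 1000000

open Polynomial

theorem Polynomial.not_lt_lt_of_comap_C_eq {R : Type*} [CommRing R] {Q₀ Q₁ Q₂ : Ideal R[X]}
    [h₀ : Q₀.IsPrime] [h₁ : Q₁.IsPrime] [h₂ : Q₂.IsPrime] (h01 : Q₀ < Q₁)
    (hc₁ : Q₁.comap C = Q₀.comap C) (hc₂ : Q₂.comap C = Q₀.comap C) : ¬ Q₁ < Q₂ := by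
  intro h12
  let p : PrimeSpectrum R := PrimeSpectrum.comap C ⟨Q₀, h₀⟩
  have hdim : Order.krullDim (PrimeSpectrum.comap (algebraMap R R[X]) ⁻¹' {p}) ≤ 1 := by
    rw [Order.krullDim_eq_of_orderIso
      (PrimeSpectrum.preimageOrderIsoFiber R (Polynomial R) p), ← ringKrullDim,
      ← ringKrullDim_eq_of_ringEquiv (polyEquivTensor R (p.asIdeal.ResidueField)).toRingEquiv]
    exact Ring.krullDimLE_iff.mp (inferInstance : Ring.KrullDimLE 1 _)
  let q₀ : PrimeSpectrum.comap (algebraMap R R[X]) ⁻¹' {p} := ⟨⟨Q₀, h₀⟩, rfl⟩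
  let q₁ : PrimeSpectrum.comap (algebraMap R R[X]) ⁻¹' {p} :=
    ⟨⟨Q₁, h₁⟩, PrimeSpectrum.ext hc₁⟩
  let q₂ : PrimeSpectrum.comap (algebraMap R R[X]) ⁻¹' {p} :=
    ⟨⟨Q₂, h₂⟩, PrimeSpectrum.ext hc₂⟩
  have hq01 : q₀ < q₁ := h01
  have hq12 : q₁ < q₂ := h12
  let l₁ : LTSeries (PrimeSpectrum.comap (algebraMap R R[X]) ⁻¹' {p}) :=
    (RelSeries.singleton _ q₂).cons q₁ hq12
  let l : LTSeries (PrimeSpectrum.comap (algebraMap R R[X]) ⁻¹' {p}) := l₁.cons q₀ hq01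
  have hl : (l.length : WithBot ℕ∞) ≤ 1 := (Order.LTSeries.length_le_krullDim l).trans hdim
  have : l.length = 2 := rfl
  rw [this] at hl
  exact absurd hl (by decide)

theorem Ideal.comap_C_map_C {R : Type*} [CommRing R] (P : Ideal R) :
    (P.map (C : R →+* R[X])).comap C = P := by
  refine le_antisymm (fun x hx ↦ ?_) Ideal.le_comap_map
  simpa using Ideal.mem_map_C_iff.mp (Ideal.mem_comap.mp hx) 0

theorem IsStrongS.height_le {R : Type*} [CommRing R] (h : IsStrongS R) (n : ℕ) :
    ∀ P : Ideal R, P.IsPrime → P.height ≤ n →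
      (P.map (C : R →+* R[X])).height ≤ n ∧
      ∀ Q : Ideal R[X], Q.IsPrime → Q.comap C = P → Q.height ≤ (n + 1 : ℕ) := by
  induction n using Nat.strong_induction_on with
  | _ n ih =>
  intro P hP hn
  have hPX : (P.map (C : R →+* R[X])).IsPrime := (Ideal.isPrime_map_C_iff_isPrime P).mpr hP
  have hlt (P' : Ideal R) (hP' : P'.IsPrime) (hlt : P' < P) :
      ∃ k : ℕ, k < n ∧ P'.height = k := by
    have := (Ideal.height_le_iff.mp hn) P' hP' hlt
    obtain ⟨k, hk⟩ := ENat.ne_top_iff_exists.mp this.ne_top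
    exact ⟨k, by rw [← hk] at this; exact_mod_cast this, hk.symm⟩
  have key : (P.map (C : R →+* R[X])).height ≤ n := by
    refine Ideal.height_le_iff.mpr fun Q' hQ' hQ'P ↦ ?_
    have hP' : (Q'.comap (C : R →+* R[X])).IsPrime := Ideal.comap_isPrime _ _
    have hle : Q'.comap C ≤ P := (Ideal.comap_mono hQ'P.le).trans_eq P.comap_C_map_C
    have hmap : (Q'.comap C).map (C : R →+* R[X]) ≤ Q' := Ideal.map_comap_le
    have hP'P : Q'.comap C < P := by
      refine lt_of_le_of_ne hle fun he ↦ ?_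
      rw [he] at hmap
      exact hQ'P.not_ge hmap
    obtain ⟨k, hkn, hk⟩ := hlt _ hP' hP'P
    obtain ⟨ih₁, ih₂⟩ := ih k hkn _ hP' hk.le
    rcases hmap.eq_or_lt with he | hlt'
    · rw [he] at ih₁
      exact ih₁.trans_lt (by exact_mod_cast hkn)
    · have hnadj : ¬ AdjacentPrimes (Q'.comap C) P := fun hadj ↦
        (h _ _ hadj).2.2.2 Q' hQ' hlt' hQ'P
      simp only [AdjacentPrimes, not_and, not_forall, not_not] at hnadj
      obtain ⟨P'', hP'', h1, h2⟩ := hnadj hP' hP hP'P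
      obtain ⟨j, hjn, hj⟩ := hlt P'' hP'' h2
      have hkj : (k : ℕ∞) + 1 ≤ j := by
        rw [← hk, ← hj]
        exact Ideal.height_add_one_le_of_lt_of_isPrime h1
      have hkj' : k + 1 ≤ j := by exact_mod_cast hkj
      refine (ih₂ Q' hQ' rfl).trans_lt ?_
      exact_mod_cast hkj'.trans_lt hjn
  refine ⟨key, fun Q hQ hQP ↦ Ideal.height_le_iff.mpr fun Q' hQ' hQ'Q ↦ ?_⟩
  have hP' : (Q'.comap (C : R →+* R[X])).IsPrime := Ideal.comap_isPrime _ _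
  have hle : Q'.comap C ≤ P := (Ideal.comap_mono hQ'Q.le).trans_eq hQP
  rcases hle.eq_or_lt with he | hP'P
  · have hmap : P.map (C : R →+* R[X]) ≤ Q' := Ideal.map_le_iff_le_comap.mpr he.ge
    rcases hmap.eq_or_lt with he' | hlt'
    · rw [← he']
      exact key.trans_lt (by exact_mod_cast n.lt_succ_self)
    · exact absurd hQ'Q (Polynomial.not_lt_lt_of_comap_C_eq hlt'
        (he.trans P.comap_C_map_C.symm) (hQP.trans P.comap_C_map_C.symm))
  · obtain ⟨k, hkn, hk⟩ := hlt _ hP' hP'P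
    refine ((ih k hkn _ hP' hk.le).2 Q' hQ' rfl).trans_lt ?_
    exact_mod_cast Nat.succ_lt_succ hkn

theorem IsStrongS.ringKrullDim_polynomial_le {R : Type*} [CommRing R] (h : IsStrongS R) {d : ℕ}
    (hd : ringKrullDim R ≤ d) : ringKrullDim R[X] ≤ (d + 1 : ℕ) := by
  refine (ringKrullDim_le_iff_height_le _).mpr fun Q hQ ↦ ?_
  have hP : (Q.comap (C : R →+* R[X])).IsPrime := Ideal.comap_isPrime _ _
  have hPd : (Q.comap (C : R →+* R[X])).height ≤ d := by
    have := (Ideal.height_le_ringKrullDim_of_ne_top hP.ne_top).trans hd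
    exact_mod_cast this
  exact_mod_cast (h.height_le d _ hP hPd).2 Q hQ rfl

theorem IsStrongS.of_surjective {A B : Type*} [CommRing A] [CommRing B] (h : IsStrongS A)
    (f : A →+* B) (hf : Function.Surjective f) : IsStrongS B := by
  intro P₁ P₂ ⟨hP₁, hP₂, hlt, hadj⟩
  have hstrict {I J : Ideal B} : I.comap f < J.comap f ↔ I < J := by
    simp only [lt_iff_le_not_ge, Ideal.comap_le_comap_iff_of_surjective f hf]
  have hfX : Function.Surjective (mapRingHom f) := Polynomial.map_surjective f hf
  have hstrictX {I J : Ideal B[X]} :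
      I.comap (mapRingHom f) < J.comap (mapRingHom f) ↔ I < J := by
    simp only [lt_iff_le_not_ge, Ideal.comap_le_comap_iff_of_surjective _ hfX]
  have hcomap (P : Ideal B) :
      (P.map (C : B →+* B[X])).comap (mapRingHom f) = (P.comap f).map C := by
    ext p
    simp [Ideal.mem_map_C_iff, Polynomial.coeff_map]
  have hA : AdjacentPrimes (P₁.comap f) (P₂.comap f) := by
    refine ⟨Ideal.comap_isPrime _ _, Ideal.comap_isPrime _ _, hstrict.mpr hlt, ?_⟩
    intro Q hQ h1 h2
    have hker : RingHom.ker f ≤ Q := (Ideal.comap_mono bot_le).trans h1.le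
    have hQf : (Q.map f).comap f = Q := by
      rw [Ideal.comap_map_of_surjective f hf]
      exact sup_eq_left.mpr hker
    rw [← hQf] at h1 h2
    exact hadj (Q.map f) (Ideal.map_isPrime_of_surjective hf hker) (hstrict.mp h1) (hstrict.mp h2)
  obtain ⟨-, -, hltX, hadjX⟩ := h _ _ hA
  rw [← hcomap, ← hcomap] at hltX hadjX
  refine ⟨(Ideal.isPrime_map_C_iff_isPrime _).mpr hP₁, (Ideal.isPrime_map_C_iff_isPrime _).mpr hP₂,
    hstrictX.mp hltX, fun Q hQ h1 h2 ↦ ?_⟩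
  exact hadjX _ (Ideal.comap_isPrime _ Q) (hstrictX.mpr h1) (hstrictX.mpr h2)

/-- `R` is stably strong S: all polynomial rings over `R` in finitely many variables are
strong S. -/
def IsStablyStrongS (R : Type*) [CommRing R] : Prop :=
  ∀ n : ℕ, IsStrongS (MvPolynomial (Fin n) R)

theorem IsStablyStrongS.isStrongS {R : Type*} [CommRing R] (h : IsStablyStrongS R) :
    IsStrongS R :=
  (h 0).of_surjective (MvPolynomial.isEmptyRingEquiv R (Fin 0)).toRingHom
    (MvPolynomial.isEmptyRingEquiv R (Fin 0)).surjective

theorem IsStablyStrongS.of_surjective_polynomial {A B : Type*} [CommRing A] [CommRing B]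
    (h : IsStablyStrongS A) (f : A[X] →+* B) (hf : Function.Surjective f) :
    IsStablyStrongS B := by
  intro n
  let e : MvPolynomial (Fin (n + 1)) A ≃ₐ[A] MvPolynomial (Fin n) A[X] :=
    (MvPolynomial.renameEquiv A (_root_.finSuccEquiv n)).trans
      (MvPolynomial.optionEquivRight A (Fin n))
  exact (h (n + 1)).of_surjective ((MvPolynomial.map f).comp e.toRingEquiv.toRingHom)
    ((MvPolynomial.map_surjective f hf).comp e.surjective)

theorem IsStablyStrongS.exists_subalgebra {D : Type*} [CommRing D] [IsDomain D] {K : Type*}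
    [Field K] [Algebra D K] [IsFractionRing D K] (h : IsStablyStrongS D) {d : ℕ}
    (hd : ringKrullDim D ≤ d) (V : Subalgebra D K) (s : Finset K) (hs : (s : Set K) ⊆ V) :
    ∃ S : Subalgebra D K, (s : Set K) ⊆ S ∧ S ≤ V ∧ IsStablyStrongS S ∧ ringKrullDim S ≤ d := by
  classical
  induction s using Finset.induction_on with
  | empty =>
    have hsurj : Function.Surjective (algebraMap D (⊥ : Subalgebra D K)) := fun ⟨x, hx⟩ ↦ by
      obtain ⟨y, hy⟩ := Algebra.mem_bot.mp hx
      exact ⟨y, Subtype.ext hy⟩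
    refine ⟨⊥, by simp, bot_le, ?_, (ringKrullDim_le_of_surjective _ hsurj).trans hd⟩
    exact h.of_surjective_polynomial ((algebraMap D (⊥ : Subalgebra D K)).comp constantCoeff)
      (hsurj.comp fun x ↦ ⟨C x, by simp⟩)
  | insert x s _ ih =>
    rw [Finset.coe_insert, Set.insert_subset_iff] at hs
    obtain ⟨S, hsS, hSV, hS, hSd⟩ := ih hs.2
    let φ : S[X] →ₐ[D] K := (Polynomial.aeval (R := S) x).restrictScalars D
    have hφ (p : S[X]) : φ p = p.eval₂ (algebraMap S K) x := rfl
    have hsurj : Function.Surjective φ.rangeRestrict := φ.rangeRestrict_surjective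
    have hSφ : S ≤ φ.range := fun y hy ↦ ⟨C ⟨y, hy⟩, by simp [hφ]⟩
    refine ⟨φ.range, ?_, ?_, hS.of_surjective_polynomial φ.rangeRestrict.toRingHom hsurj, ?_⟩
    · rw [Finset.coe_insert, Set.insert_subset_iff]
      exact ⟨⟨X, by simp [hφ]⟩, hsS.trans hSφ⟩
    · rintro _ ⟨p, rfl⟩
      change p.eval₂ (algebraMap S K) x ∈ V
      rw [Polynomial.eval₂_eq_sum_range]
      exact sum_mem fun i _ ↦ mul_mem (hSV (p.coeff i).2) (pow_mem hs.1 i)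
    · obtain ⟨a, b, hb, rfl⟩ := IsFractionRing.div_surjective (A := D) x
      have hbK : algebraMap D K b ≠ 0 := IsFractionRing.to_map_ne_zero_of_mem_nonZeroDivisors hb
      let r : S[X] := C (algebraMap D S b) * X - C (algebraMap D S a)
      have hr : r ≠ 0 := by
        intro hr
        have := congrArg (fun p ↦ p.coeff 1) hr
        simp only [r, coeff_sub, coeff_C_mul, coeff_X_one, coeff_C_succ, coeff_zero, mul_one,
          sub_zero] at this
        exact hbK (congrArg Subtype.val this)
      have hφr : φ.rangeRestrict r = 0 := by
        apply Subtype.ext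
        change φ r = 0
        simp only [hφ, r, eval₂_sub, eval₂_mul, eval₂_C, eval₂_X,
          ← IsScalarTower.algebraMap_apply D S K]
        field_simp
        simp
      have h1 := ringKrullDim_succ_le_of_surjective φ.rangeRestrict.toRingHom hsurj
        (mem_nonZeroDivisors_of_ne_zero hr) hφr
      have h2 := h1.trans (hS.isStrongS.ringKrullDim_polynomial_le hSd)
      push_cast at h2
      exact ENat.WithBot.add_le_add_one_right_iff.mp h2

theorem IsStablyStrongS.ringKrullDim_le {D : Type*} [CommRing D] [IsDomain D] {K : Type*}
    [Field K] [Algebra D K] [IsFractionRing D K] (h : IsStablyStrongS D) {d : ℕ}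
    (hd : ringKrullDim D ≤ d) (V : Subalgebra D K) : ringKrullDim V ≤ d := by
  classical
  refine iSup_le fun l ↦ ?_
  have hex (i : Fin l.length) :
      ∃ x : V, x ∈ (l i.succ).asIdeal ∧ x ∉ (l i.castSucc).asIdeal :=
    SetLike.exists_of_lt (l.step i)
  choose x hx hx' using hex
  obtain ⟨S, hS, hSV, -, hSd⟩ := h.exists_subalgebra hd V
    (Finset.univ.image fun i ↦ (x i : K)) (by
      intro y hy
      simp only [Finset.coe_image, Set.mem_image] at hy
      obtain ⟨i, -, rfl⟩ := hy
      exact (x i).2)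
  let g := (Subalgebra.inclusion hSV).toRingHom
  let l' : LTSeries (PrimeSpectrum S) :=
    { length := l.length
      toFun := fun i ↦ PrimeSpectrum.comap g (l i)
      step := fun i ↦ by
        refine lt_of_le_not_ge (Ideal.comap_mono (l.step i).le) fun hle ↦ ?_
        have hxS : (x i : K) ∈ S := hS (by simp)
        exact hx' i (hle (show (⟨x i, hxS⟩ : S) ∈ _ from hx i)) }
  exact (Order.LTSeries.length_le_krullDim l').trans hSd

theorem ValuationSubring.exists_comap_maximalIdeal_eq {R K : Type*} [CommRing R] [Field K]
    (f : R →+* K) (P : Ideal R) [P.IsPrime] (hP : RingHom.ker f ≤ P) :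
    ∃ (V : ValuationSubring K) (g : R →+* V), (∀ r, (g r : K) = f r) ∧
      (IsLocalRing.maximalIdeal V).comap g = P := by
  have hu (y : P.primeCompl) : IsUnit (f y) := by
    rw [isUnit_iff_ne_zero]
    exact fun h0 ↦ y.2 (hP h0)
  let F : Localization.AtPrime P →+* K := IsLocalization.lift hu
  obtain ⟨V, hV, hloc⟩ := IsLocalRing.exists_factor_valuationRing F
  let G : Localization.AtPrime P →+* V := F.codRestrict V.toSubring hV
  have hG : IsLocalHom G := hloc
  refine ⟨V, G.comp (algebraMap R _), fun r ↦ IsLocalization.lift_eq hu r, ?_⟩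
  have hmax : (IsLocalRing.maximalIdeal V).comap G = IsLocalRing.maximalIdeal _ :=
    ((IsLocalRing.local_hom_TFAE G).out 0 4).mp hG
  rw [← Ideal.comap_comap, hmax]
  exact IsLocalization.AtPrime.under_maximalIdeal _ P

/-- The composite of a valuation ring `V` with a valuation ring `W` of its residue field. -/
def ValuationSubring.composite {K : Type*} [Field K] (V : ValuationSubring K)
    (W : ValuationSubring (IsLocalRing.ResidueField V)) : ValuationSubring K :=
  .ofSubring ((W.toSubring.comap (IsLocalRing.residue V)).map V.subtype) fun x ↦ by
    wlog hx : x ∈ V generalizing x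
    · have := this x⁻¹ ((V.mem_or_inv_mem x).resolve_left hx)
      rwa [inv_inv, or_comm] at this
    by_cases hr : IsLocalRing.residue V ⟨x, hx⟩ = 0
    · exact .inl ⟨⟨x, hx⟩, by simp [hr], rfl⟩
    · have hunit : IsUnit (⟨x, hx⟩ : V) := by
        by_contra hn
        exact hr ((IsLocalRing.residue_eq_zero_iff _).mpr hn)
      obtain ⟨u, hu⟩ := hunit
      have hux : (u : V).1 = x := congrArg Subtype.val hu
      have huv : ((u⁻¹ : Vˣ) : V).1 = x⁻¹ := by
        refine eq_inv_of_mul_eq_one_left ?_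
        rw [← hux]
        exact congrArg Subtype.val u.inv_mul
      rcases W.mem_or_inv_mem (IsLocalRing.residue V u) with h | h
      · exact .inl ⟨u, h, hux⟩
      · refine .inr ⟨(u⁻¹ : Vˣ), ?_, huv⟩
        have : IsLocalRing.residue V (u⁻¹ : Vˣ) = (IsLocalRing.residue V u)⁻¹ := by
          refine eq_inv_of_mul_eq_one_left ?_
          rw [← map_mul, u.inv_mul, map_one]
        simpa [this] using h

theorem ValuationSubring.mem_composite {K : Type*} [Field K] {V : ValuationSubring K}
    {W : ValuationSubring (IsLocalRing.ResidueField V)} {x : K} :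
    x ∈ V.composite W ↔ ∃ v : V, IsLocalRing.residue V v ∈ W ∧ (v : K) = x :=
  Iff.rfl

theorem ValuationSubring.ringKrullDim_composite {K : Type*} [Field K] (V : ValuationSubring K)
    (W : ValuationSubring (IsLocalRing.ResidueField V))
    (hV : IsLocalRing.maximalIdeal V ≠ ⊥) :
    ringKrullDim W + 1 ≤ ringKrullDim (V.composite W) := by
  have hle : (V.composite W).toSubring ≤ V.toSubring := by
    rintro _ ⟨v, -, rfl⟩
    exact v.2
  let i : V.composite W →+* V := Subring.inclusion hle
  have hi (x : V.composite W) : IsLocalRing.residue V (i x) ∈ W.toSubring := by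
    obtain ⟨v, hv, hvx⟩ := mem_composite.mp x.2
    have : i x = v := Subtype.ext hvx.symm
    rwa [this]
  let g : V.composite W →+* W := ((IsLocalRing.residue V).comp i).codRestrict W.toSubring hi
  have hg : Function.Surjective g := fun ⟨w, hw⟩ ↦ by
    obtain ⟨v, rfl⟩ := IsLocalRing.residue_surjective w
    exact ⟨⟨v, mem_composite.mpr ⟨v, hw, rfl⟩⟩, rfl⟩
  obtain ⟨v, hv, hv0⟩ := Submodule.exists_mem_ne_zero_of_ne_bot hV
  have hvres : IsLocalRing.residue V v = 0 := (IsLocalRing.residue_eq_zero_iff v).mpr hv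
  refine ringKrullDim_succ_le_of_surjective g hg
    (r := ⟨v, mem_composite.mpr ⟨v, by rw [hvres]; exact zero_mem W, rfl⟩⟩)
    (mem_nonZeroDivisors_of_ne_zero fun h0 ↦ hv0 (Subtype.ext (congrArg Subtype.val h0 :)))
    (Subtype.ext hvres)

theorem ValuationSubring.exists_le_ringKrullDim.{u, v} {R : Type u} [CommRing R] (n : ℕ) :
    ∀ (K : Type v) [Field K] (f : R →+* K) (l : LTSeries (PrimeSpectrum R)), l.length = n →
      RingHom.ker f ≤ l.head.asIdeal →
      ∃ V : ValuationSubring K, (∀ r, f r ∈ V) ∧ (n : WithBot ℕ∞) ≤ ringKrullDim V := by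
  induction n with
  | zero =>
    intro K _ f l _ _
    exact ⟨⊤, fun r ↦ mem_top _, ringKrullDim_nonneg_of_nontrivial⟩
  | succ n ih =>
    intro K _ f l hl hf
    have hl0 : l.length ≠ 0 := by omega
    have : NeZero l.length := ⟨hl0⟩
    have hlt : l.head < (l.tail hl0).head := by
      rw [RelSeries.head_tail]
      exact l.strictMono (Fin.lt_def.mpr (by simp [Nat.mod_eq_of_lt, hl]))
    obtain ⟨V, g, hgf, hg⟩ := exists_comap_maximalIdeal_eq f (l.tail hl0).head.asIdeal
      (hf.trans hlt.le)
    obtain ⟨W, hgW, hW⟩ := ih (IsLocalRing.ResidueField V) ((IsLocalRing.residue V).comp g)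
      (l.tail hl0) (by simp [hl]) (by
        rw [← RingHom.comap_ker, IsLocalRing.ker_residue, hg])
    refine ⟨V.composite W, fun r ↦ mem_composite.mpr ⟨g r, hgW r, hgf r⟩, ?_⟩
    have hV : IsLocalRing.maximalIdeal V ≠ ⊥ := by
      intro hbot
      obtain ⟨r, hr, hr'⟩ := SetLike.exists_of_lt (show l.head.asIdeal < _ from hlt)
      rw [← hg, hbot] at hr
      have hgr : g r = 0 := hr
      refine hr' (hf ?_)
      rw [RingHom.mem_ker, ← hgf, hgr]
      rfl
    refine le_trans ?_ (V.ringKrullDim_composite W hV)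
    push_cast
    gcongr

theorem ringKrullDim_le_valuativeDim (D : Type*) [CommRing D] [IsDomain D] :
    ringKrullDim D ≤ valuativeDim D := by
  refine iSup_le fun l ↦ ?_
  obtain ⟨V, hDV, hV⟩ := ValuationSubring.exists_le_ringKrullDim l.length (FractionRing D)
    (algebraMap D (FractionRing D)) l rfl (by
      rw [(RingHom.injective_iff_ker_eq_bot _).mp (IsFractionRing.injective D (FractionRing D))]
      exact bot_le)
  let V' : Subalgebra D (FractionRing D) := { V.toSubring with algebraMap_mem' := hDV }
  have hV' : ValuationRing V' := inferInstanceAs (ValuationRing V)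
  exact hV.trans (le_iSup₂_of_le (f := fun (V : Subalgebra D (FractionRing D))
    (_ : ValuationRing V) ↦ ringKrullDim V) V' hV' le_rfl)

/-- A stably strong S-domain of finite Krull dimension is Jaffard. -/
theorem statement_14 (D : Type*) [CommRing D] [IsDomain D]
    (h : ∀ n : ℕ, IsStrongS (MvPolynomial (Fin n) D))
    (hfin : ringKrullDim D < ⊤) : ringKrullDim D = valuativeDim D := by
  obtain ⟨d, hd⟩ : ∃ d : ℕ, ringKrullDim D = d := by
    obtain ⟨e, he⟩ := WithBot.ne_bot_iff_exists.mp
      (Order.bot_lt_krullDim (α := PrimeSpectrum D)).ne'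
    have he' : e ≠ ⊤ := by
      rintro rfl
      exact hfin.ne he.symm
    obtain ⟨d, rfl⟩ := ENat.ne_top_iff_exists.mp he'
    exact ⟨d, he.symm⟩
  refine le_antisymm (ringKrullDim_le_valuativeDim D) (iSup₂_le fun V _ ↦ ?_)
  rw [hd]
  exact IsStablyStrongS.ringKrullDim_le h hd.le V
end
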